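/- Let 0 < α < 1, γ_α = 2 sin(πα)/π, ε ≥ 0, a, b ∈ ℝ, and let μ_1, …, μ_L and θ_1, …, θ_L be positive reals. Let u and ψ_1, …, ψ_L be C¹ functions of (x, t) ∈ ℝ × [0, T), compactly supported in x for each t (together with their derivatives), satisfying ∂_t u + ∂_x (a u + b u²/2) + ε Σ_{ℓ=1}^L μ_ℓ ∂_t ψ_ℓ = 0 and ∂_t ψ_ℓ = −θ_ℓ² ψ_ℓ + γ_α θ_ℓ^{2α−1} u for ℓ = 1, …, L. Define the energy E(t) = (1/2) ∫_ℝ u(x,t)² dx + (1/2) Σ_{ℓ=1}^L (ε/γ_α) μ_ℓ θ_ℓ^{3−2α} ∫_ℝ ψ_ℓ(x,t)² dx. Then for every t, dE/dt = − Σ_{ℓ=1}^L (ε/γ_α) μ_ℓ θ_ℓ^{1−2α} ∫_ℝ (∂_t ψ_ℓ(x,t))² dx; in particular E is nonincreasing. -/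

import Mathlib

open Real Set MeasureTheory

open scoped Topology in
/-- A function that is continuous at the left endpoint `c` of `[c, d)` and whose derivative on
`(c, d)` extends continuously to `[c, d)` has that extension as its derivative on `[c, d)`. -/
theorem hasDerivWithinAt_Ico_of_continuousOn {F D : ℝ → ℝ} {c d : ℝ}
    (hF : ContinuousOn F (Ico c d)) (hD : ContinuousOn D (Ico c d))
    (hFD : ∀ t ∈ Ioo c d, HasDerivAt F (D t) t) {t : ℝ} (ht : t ∈ Ico c d) :
    HasDerivWithinAt F (D t) (Ico c d) t := by
  rcases ht.1.eq_or_lt with rfl | hlt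
  · have hmem : Ioo c d ∈ 𝓝[>] c := Ioo_mem_nhdsGT ht.2
    refine (hasDerivWithinAt_Ici_of_tendsto_deriv (s := Ioo c d)
      (fun s hs => (hFD s hs).differentiableAt.differentiableWithinAt)
      ((hF c ht).mono Ioo_subset_Ico_self) hmem ?_).mono Ico_subset_Ici_self
    have hlim : Filter.Tendsto D (𝓝[>] c) (𝓝 (D c)) := by
      rw [← nhdsWithin_Ioo_eq_nhdsGT ht.2]
      exact (hD c ht).mono Ioo_subset_Ico_self
    refine hlim.congr' ?_
    filter_upwards [hmem] with s hs using (hFD s hs).deriv.symm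
  · exact (hFD t ⟨hlt, ht.2⟩).hasDerivWithinAt

theorem hasCompactSupport_of_forall_lt_abs {g : ℝ → ℝ} {M : ℝ} (hg : ∀ x, M < |x| → g x = 0) :
    HasCompactSupport g := by
  refine HasCompactSupport.intro (isCompact_Icc (a := -M) (b := M)) fun x hx => hg x ?_
  by_contra! h
  exact hx (abs_le.1 h)

theorem continuousOn_integral_of_forall_lt_abs {f : ℝ → ℝ → ℝ} {s : Set ℝ} {M : ℝ}
    (hf : ContinuousOn (fun p : ℝ × ℝ => f p.1 p.2) (univ ×ˢ s))
    (hM : ∀ t ∈ s, ∀ x, M < |x| → f x t = 0) :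
    ContinuousOn (fun t => ∫ x, f x t) s := by
  refine continuousOn_integral_of_compact_support (f := fun t x => f x t)
    (isCompact_Icc (a := -M) (b := M)) ?_ fun t x ht hx => hM t ht x ?_
  · exact hf.comp continuous_swap.continuousOn fun p hp => ⟨mem_univ _, hp.1⟩
  · by_contra! h
    exact hx (abs_le.1 h)

/-- The slices of a function continuous on `ℝ × s` are continuous. -/
theorem continuous_slice {f : ℝ → ℝ → ℝ} {s : Set ℝ}
    (hf : ContinuousOn (fun p : ℝ × ℝ => f p.1 p.2) (univ ×ˢ s)) {t : ℝ} (ht : t ∈ s) :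
    Continuous fun x => f x t :=
  hf.comp_continuous (f := fun x : ℝ => (x, t)) (by fun_prop) fun x => ⟨mem_univ _, ht⟩

/-- Differentiation under the integral sign for `C¹` functions on `ℝ × s`, `s` open, supported in
a fixed compact set in the first variable. -/
theorem hasDerivAt_integral_of_contDiffOn {f : ℝ → ℝ → ℝ} {s : Set ℝ} {M : ℝ} (hs : IsOpen s)
    (hf : ContDiffOn ℝ 1 (fun p : ℝ × ℝ => f p.1 p.2) (univ ×ˢ s))
    (hM : ∀ t ∈ s, ∀ x, M < |x| → f x t = 0) {t : ℝ} (ht : t ∈ s) :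
    Integrable (fun x => deriv (f x) t) ∧
      HasDerivAt (fun r => ∫ x, f x r) (∫ x, deriv (f x) t) t := by
  set F : ℝ × ℝ → ℝ := fun p => f p.1 p.2
  have hopen : IsOpen ((univ : Set ℝ) ×ˢ s) := isOpen_univ.prod hs
  have hderiv : ∀ x, ∀ r ∈ s, HasDerivAt (f x) (fderiv ℝ F (x, r) (0, 1)) r := by
    intro x r hr
    have h1 : HasFDerivAt F (fderiv ℝ F (x, r)) (x, r) :=
      ((hf.differentiableOn one_ne_zero).differentiableAt
        (hopen.mem_nhds ⟨mem_univ _, hr⟩)).hasFDerivAt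
    exact h1.comp_hasDerivAt r ((hasDerivAt_const r x).prodMk (hasDerivAt_id r))
  have hcont : ContinuousOn (fun p : ℝ × ℝ => deriv (f p.1) p.2) (univ ×ˢ s) := by
    refine ((hf.continuousOn_fderiv_of_isOpen hopen le_rfl).clm_apply
      (continuousOn_const (c := ((0, 1) : ℝ × ℝ)))).congr fun p hp => ?_
    exact (hderiv p.1 p.2 hp.2).deriv
  have hzero : ∀ r ∈ s, ∀ x, M < |x| → deriv (f x) r = 0 := by
    intro r hr x hx
    have : f x =ᶠ[nhds r] fun _ => 0 := by
      filter_upwards [hs.mem_nhds hr] with q hq using hM q hq x hx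
    rw [this.deriv_eq, deriv_const]
  obtain ⟨δ, hδ, hball⟩ := Metric.nhds_basis_closedBall.mem_iff.1 (hs.mem_nhds ht)
  obtain ⟨C, hC⟩ := ((isCompact_Icc (a := -M) (b := M)).prod
    (isCompact_closedBall t δ)).exists_bound_of_continuousOn
      (hcont.mono (prod_mono (subset_univ _) hball))
  refine hasDerivAt_integral_of_dominated_loc_of_deriv_le (F := fun r x => f x r)
    (F' := fun r x => deriv (f x) r) (bound := (Icc (-M) M).indicator fun _ => C)
    (Metric.closedBall_mem_nhds t hδ) ?_ ?_ ?_ ?_ ?_ ?_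
  · filter_upwards [hs.mem_nhds ht] with r hr
    exact (continuous_slice hf.continuousOn hr).aestronglyMeasurable
  · exact (continuous_slice hf.continuousOn ht).integrable_of_hasCompactSupport
      (hasCompactSupport_of_forall_lt_abs (hM t ht))
  · exact (continuous_slice (f := fun x => deriv (f x)) hcont ht).aestronglyMeasurable
  · refine .of_forall fun x r hr => ?_
    by_cases hx : x ∈ Icc (-M) M
    · rw [indicator_of_mem hx]
      exact hC (x, r) ⟨hx, hr⟩
    · rw [indicator_of_notMem hx, hzero r (hball hr) x, norm_zero]
      by_contra! h
      exact hx (abs_le.1 h)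
  · exact (integrable_indicator_iff measurableSet_Icc).2
      (integrableOn_const measure_Icc_lt_top.ne)
  · exact .of_forall fun x r hr => (hderiv x r (hball hr)).differentiableAt.hasDerivAt

theorem integral_deriv_eq_zero_of_hasCompactSupport {g : ℝ → ℝ} (hg : ContDiff ℝ 1 g)
    (hc : HasCompactSupport g) : Integrable (deriv g) ∧ ∫ x, deriv g x = 0 := by
  have hi : Integrable (deriv g) :=
    (hg.continuous_deriv le_rfl).integrable_of_hasCompactSupport hc.deriv
  exact ⟨hi, integral_eq_zero_of_hasDerivAt_of_integrable
    (fun x => (hg.differentiable one_ne_zero x).hasDerivAt) hi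
    (hg.continuous.integrable_of_hasCompactSupport hc)⟩

/-- Pointwise contribution of one memory variable to the energy balance. -/
theorem memory_energy_identity {α γ θ : ℝ} (ε m v w y : ℝ) (hγ : γ ≠ 0) (hθ : 0 < θ)
    (hw : w = -θ ^ 2 * v + γ * θ ^ (2 * α - 1) * y) :
    ε / γ * m * θ ^ (3 - 2 * α) * (v * w) + ε / γ * m * θ ^ (1 - 2 * α) * w ^ 2 =
      y * (ε * (m * w)) := by
  have h1 : θ ^ (3 - 2 * α) = θ ^ 2 * θ ^ (1 - 2 * α) := by
    rw [← Real.rpow_natCast θ 2, ← Real.rpow_add hθ]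
    congr 1
    push_cast
    ring
  have h2 : θ ^ (1 - 2 * α) * θ ^ (2 * α - 1) = 1 := by
    rw [← Real.rpow_add hθ, show 1 - 2 * α + (2 * α - 1) = 0 by ring, Real.rpow_zero]
  have h3 : θ ^ 2 * v + w = γ * θ ^ (2 * α - 1) * y := by rw [hw]; ring
  calc _ = ε / γ * m * θ ^ (1 - 2 * α) * w * (θ ^ 2 * v + w) := by rw [h1]; ring
    _ = (γ / γ) * (θ ^ (1 - 2 * α) * θ ^ (2 * α - 1)) * (y * (ε * (m * w))) := by rw [h3]; ring
    _ = _ := by rw [h2, div_self hγ]; ring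

/-- Decrease of energy for the diffusive approximation of the fractional Burger's
equation. Let `u, ψ_ℓ` be `C¹` solutions on `ℝ × [0, T)`, compactly supported in `x`,
of `∂_t u + ∂_x(a u + b u²/2) + ε Σ_ℓ μ_ℓ ∂_t ψ_ℓ = 0` and
`∂_t ψ_ℓ = -θ_ℓ² ψ_ℓ + γ_α θ_ℓ^(2α-1) u`. Then the energy
`E(t) = (1/2)∫ u² dx + (1/2) Σ_ℓ (ε/γ_α) μ_ℓ θ_ℓ^(3-2α) ∫ ψ_ℓ² dx` satisfies
`E'(t) = -Σ_ℓ (ε/γ_α) μ_ℓ θ_ℓ^(1-2α) ∫ (∂_t ψ_ℓ)² dx`; in particular `E` is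
nonincreasing. -/
theorem energy_decrease (α γα ε a b T : ℝ) (L : ℕ)
    (hα0 : 0 < α) (hα1 : α < 1)
    (hγ : γα = 2 * Real.sin (Real.pi * α) / Real.pi)
    (hε : 0 ≤ ε) (hT : 0 < T)
    (μ θ : Fin L → ℝ) (hμ : ∀ ℓ, 0 < μ ℓ) (hθ : ∀ ℓ, 0 < θ ℓ)
    (u : ℝ → ℝ → ℝ) (ψ : Fin L → ℝ → ℝ → ℝ)
    (hu : ContDiffOn ℝ 1 (fun p : ℝ × ℝ => u p.1 p.2) (Set.univ ×ˢ Set.Ico 0 T))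
    (hψ : ∀ ℓ, ContDiffOn ℝ 1 (fun p : ℝ × ℝ => ψ ℓ p.1 p.2) (Set.univ ×ˢ Set.Ico 0 T))
    (hsupp : ∃ M : ℝ, ∀ t ∈ Set.Ico (0 : ℝ) T, ∀ x : ℝ, M < |x| →
      u x t = 0 ∧ ∀ ℓ, ψ ℓ x t = 0)
    (hPDE : ∀ x : ℝ, ∀ t ∈ Set.Ico (0 : ℝ) T,
      deriv (fun s => u x s) t
        + deriv (fun y => a * u y t + b * u y t ^ 2 / 2) x
        + ε * ∑ ℓ, μ ℓ * deriv (fun s => ψ ℓ x s) t = 0)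
    (hODE : ∀ ℓ, ∀ x : ℝ, ∀ t ∈ Set.Ico (0 : ℝ) T,
      deriv (fun s => ψ ℓ x s) t = -θ ℓ ^ 2 * ψ ℓ x t + γα * θ ℓ ^ (2 * α - 1) * u x t)
    (E : ℝ → ℝ)
    (hE : ∀ t, E t = (1 / 2) * (∫ x : ℝ, u x t ^ 2)
        + (1 / 2) * ∑ ℓ, (ε / γα) * μ ℓ * θ ℓ ^ (3 - 2 * α) * ∫ x : ℝ, ψ ℓ x t ^ 2) :
    (∀ t ∈ Set.Ico (0 : ℝ) T,
      HasDerivWithinAt E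
        (-(∑ ℓ, (ε / γα) * μ ℓ * θ ℓ ^ (1 - 2 * α) *
            ∫ x : ℝ, (deriv (fun s => ψ ℓ x s) t) ^ 2))
        (Set.Ico 0 T) t) ∧
      AntitoneOn E (Set.Ico 0 T) := by
  obtain ⟨M, hM⟩ := hsupp
  have hγ0 : 0 < γα := by
    rw [hγ]
    have := Real.sin_pos_of_pos_of_lt_pi (mul_pos Real.pi_pos hα0)
      (mul_lt_of_lt_one_right Real.pi_pos hα1)
    positivity
  have hu2 : ContDiffOn ℝ 1 (fun p : ℝ × ℝ => u p.1 p.2 ^ 2) (univ ×ˢ Ico 0 T) := hu.pow 2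
  have hψ2 : ∀ ℓ, ContDiffOn ℝ 1 (fun p : ℝ × ℝ => ψ ℓ p.1 p.2 ^ 2) (univ ×ˢ Ico 0 T) :=
    fun ℓ => (hψ ℓ).pow 2
  have hu2M : ∀ t ∈ Ico 0 T, ∀ x, M < |x| → u x t ^ 2 = 0 := fun t ht x hx => by
    simp [(hM t ht x hx).1]
  have hψ2M : ∀ ℓ, ∀ t ∈ Ico 0 T, ∀ x, M < |x| → ψ ℓ x t ^ 2 = 0 := fun ℓ t ht x hx => by
    simp [(hM t ht x hx).2 ℓ]
  have hwc : ∀ ℓ, ContinuousOn (fun p : ℝ × ℝ => deriv (fun s => ψ ℓ p.1 s) p.2 ^ 2)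
      (univ ×ˢ Ico 0 T) := by
    intro ℓ
    refine ContinuousOn.congr (f := fun p : ℝ × ℝ => (-θ ℓ ^ 2 * ψ ℓ p.1 p.2 +
      γα * θ ℓ ^ (2 * α - 1) * u p.1 p.2) ^ 2) ?_ fun p hp => ?_
    · exact ((continuousOn_const.mul (hψ ℓ).continuousOn).add
        (continuousOn_const.mul hu.continuousOn)).pow 2
    · simp only [hODE ℓ p.1 p.2 hp.2]
  have hwM : ∀ ℓ, ∀ t ∈ Ico 0 T, ∀ x, M < |x| → deriv (fun s => ψ ℓ x s) t ^ 2 = 0 := by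
    intro ℓ t ht x hx
    rw [hODE ℓ x t ht, (hM t ht x hx).1, (hM t ht x hx).2 ℓ]
    ring
  have hEc : ContinuousOn E (Ico 0 T) := by
    rw [funext hE]
    exact (continuousOn_const.mul
      (continuousOn_integral_of_forall_lt_abs hu2.continuousOn hu2M)).add
      (continuousOn_const.mul (continuousOn_finsetSum _ fun ℓ _ => continuousOn_const.mul
        (continuousOn_integral_of_forall_lt_abs (hψ2 ℓ).continuousOn (hψ2M ℓ))))
  have hDc : ContinuousOn (fun t => -(∑ ℓ, (ε / γα) * μ ℓ * θ ℓ ^ (1 - 2 * α) *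
      ∫ x : ℝ, (deriv (fun s => ψ ℓ x s) t) ^ 2)) (Ico 0 T) :=
    (continuousOn_finsetSum _ fun ℓ _ => continuousOn_const.mul
      (continuousOn_integral_of_forall_lt_abs (hwc ℓ) (hwM ℓ))).neg
  have hED : ∀ t ∈ Ioo 0 T, HasDerivAt E (-(∑ ℓ, (ε / γα) * μ ℓ * θ ℓ ^ (1 - 2 * α) *
      ∫ x : ℝ, (deriv (fun s => ψ ℓ x s) t) ^ 2)) t := by
    intro t ht
    have ht' : t ∈ Ico 0 T := Ioo_subset_Ico_self ht
    have hsub : (univ : Set ℝ) ×ˢ Ioo 0 T ⊆ univ ×ˢ Ico 0 T :=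
      prod_mono subset_rfl Ioo_subset_Ico_self
    have hslice : ∀ {f : ℝ → ℝ → ℝ},
        ContDiffOn ℝ 1 (fun p : ℝ × ℝ => f p.1 p.2) (univ ×ˢ Ico 0 T) → ∀ x,
        DifferentiableAt ℝ (fun s => f x s) t := by
      intro f hf x
      have h : DifferentiableAt ℝ (fun p : ℝ × ℝ => f p.1 p.2) (x, t) :=
        ((hf.mono hsub).differentiableOn one_ne_zero).differentiableAt
          ((isOpen_univ.prod isOpen_Ioo).mem_nhds ⟨mem_univ _, ht⟩)
      exact h.comp t (f := fun s : ℝ => (x, s)) (by fun_prop)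
    have hux : ContDiff ℝ 1 fun x => u x t := by
      rw [← contDiffOn_univ]
      exact hu.comp (f := fun x : ℝ => (x, t)) (by fun_prop) fun x _ => ⟨mem_univ _, ht'⟩
    obtain ⟨hUi, hUd⟩ := hasDerivAt_integral_of_contDiffOn (f := fun x t => u x t ^ 2)
      isOpen_Ioo (hu2.mono hsub) (fun r hr => hu2M r (Ioo_subset_Ico_self hr)) ht
    have hV := fun ℓ => hasDerivAt_integral_of_contDiffOn (f := fun x t => ψ ℓ x t ^ 2)
      isOpen_Ioo ((hψ2 ℓ).mono hsub) (fun r hr => hψ2M ℓ r (Ioo_subset_Ico_self hr)) ht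
    have hWi : ∀ ℓ, Integrable fun x => deriv (fun s => ψ ℓ x s) t ^ 2 := fun ℓ =>
      (continuous_slice (f := fun x t => deriv (fun s => ψ ℓ x s) t ^ 2) (hwc ℓ) ht').integrable_of_hasCompactSupport
        (hasCompactSupport_of_forall_lt_abs (hwM ℓ t ht'))
    obtain ⟨hGi, hG0⟩ := integral_deriv_eq_zero_of_hasCompactSupport
      (g := fun x => a * u x t ^ 2 / 2 + b * u x t ^ 3 / 3) (by fun_prop)
      (hasCompactSupport_of_forall_lt_abs (M := M) fun x hx => by simp [(hM t ht' x hx).1])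
    have hpt : ∀ x, 1 / 2 * deriv (fun s => u x s ^ 2) t +
        (∑ ℓ, (1 / 2 * (ε / γα * μ ℓ * θ ℓ ^ (3 - 2 * α)) * deriv (fun s => ψ ℓ x s ^ 2) t +
          ε / γα * μ ℓ * θ ℓ ^ (1 - 2 * α) * deriv (fun s => ψ ℓ x s) t ^ 2)) +
        deriv (fun x => a * u x t ^ 2 / 2 + b * u x t ^ 3 / 3) x = 0 := by
      intro x
      have hU : deriv (fun s => u x s ^ 2) t = 2 * u x t * deriv (fun s => u x s) t := by
        simpa using ((hslice hu x).hasDerivAt.fun_pow 2).deriv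
      have hV : ∀ ℓ, deriv (fun s => ψ ℓ x s ^ 2) t =
          2 * ψ ℓ x t * deriv (fun s => ψ ℓ x s) t := fun ℓ => by
        simpa using ((hslice (hψ ℓ) x).hasDerivAt.fun_pow 2).deriv
      have hx := (hux.differentiable one_ne_zero x).hasDerivAt
      have hF := ((hx.const_mul a).fun_add (((hx.fun_pow 2).const_mul b).div_const 2)).deriv
      have hG := ((((hx.fun_pow 2).const_mul a).div_const 2).fun_add
        (((hx.fun_pow 3).const_mul b).div_const 3)).deriv
      have hP := hPDE x t ht'
      have hsum : ∑ ℓ, (1 / 2 * (ε / γα * μ ℓ * θ ℓ ^ (3 - 2 * α)) *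
            deriv (fun s => ψ ℓ x s ^ 2) t +
          ε / γα * μ ℓ * θ ℓ ^ (1 - 2 * α) * deriv (fun s => ψ ℓ x s) t ^ 2) =
          u x t * (ε * ∑ ℓ, μ ℓ * deriv (fun s => ψ ℓ x s) t) := by
        rw [Finset.mul_sum, Finset.mul_sum]
        refine Finset.sum_congr rfl fun ℓ _ => ?_
        rw [← memory_energy_identity ε (μ ℓ) _ _ _ hγ0.ne' (hθ ℓ) (hODE ℓ x t ht'), hV ℓ]
        ring
      rw [hsum, hU, hG]
      rw [hF] at hP
      linear_combination u x t * hP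
    have hsi : ∀ ℓ, Integrable fun x =>
        1 / 2 * (ε / γα * μ ℓ * θ ℓ ^ (3 - 2 * α)) * deriv (fun s => ψ ℓ x s ^ 2) t +
          ε / γα * μ ℓ * θ ℓ ^ (1 - 2 * α) * deriv (fun s => ψ ℓ x s) t ^ 2 := fun ℓ =>
      ((hV ℓ).1.const_mul _).add ((hWi ℓ).const_mul _)
    have hbal := integral_congr_ae (μ := volume) (.of_forall hpt)
    rw [integral_add ((hUi.const_mul _).fun_add (integrable_finsetSum _ fun ℓ _ => hsi ℓ)) hGi,
      integral_add (hUi.const_mul _) (integrable_finsetSum _ fun ℓ _ => hsi ℓ),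
      integral_finsetSum _ fun ℓ _ => hsi ℓ, hG0, integral_const_mul, integral_zero] at hbal
    simp_rw [fun ℓ => integral_add ((hV ℓ).1.const_mul
      (1 / 2 * (ε / γα * μ ℓ * θ ℓ ^ (3 - 2 * α))))
      ((hWi ℓ).const_mul (ε / γα * μ ℓ * θ ℓ ^ (1 - 2 * α))), integral_const_mul,
      Finset.sum_add_distrib] at hbal
    rw [funext hE]
    refine ((hUd.const_mul (1 / 2)).fun_add ((HasDerivAt.fun_sum (u := Finset.univ) fun ℓ _ =>
      (hV ℓ).2.const_mul (ε / γα * μ ℓ * θ ℓ ^ (3 - 2 * α))).const_mul (1 / 2))).congr_deriv ?_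
    rw [Finset.mul_sum]
    simp_rw [← mul_assoc] at hbal ⊢
    linear_combination hbal
  refine ⟨fun t ht => hasDerivWithinAt_Ico_of_continuousOn hEc hDc hED ht, ?_⟩
  refine antitoneOn_of_deriv_nonpos (convex_Ico 0 T) hEc ?_ ?_ <;> rw [interior_Ico]
  · exact fun t ht => (hED t ht).differentiableAt.differentiableWithinAt
  · intro t ht
    rw [(hED t ht).deriv, neg_nonpos]
    refine Finset.sum_nonneg fun ℓ _ => mul_nonneg ?_ (integral_nonneg fun x => sq_nonneg _)
    have := hμ ℓ
    have := hθ ℓ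
    positivity
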